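/- arXiv:1101.4305 — 2 statements merged into one kernel-verified Lean document; each statement's English description precedes it below -/
import Mathlib

section
/- Suppose [y,x] = 1 for elements x, y of the first Weyl algebra A₁ over a field K of characteristic zero, and let δ := ad(x)∘ad(y). Then the kernel of δ on A₁ equals K[x] + K[y], the sum of the polynomial subalgebras generated by x and by y. -/
def weylRel (K : Type*) [CommRing K] :
    FreeAlgebra K (Fin 2) → FreeAlgebra K (Fin 2) → Prop :=
  fun a b => a = FreeAlgebra.ι K 1 * FreeAlgebra.ι K 0 ∧
    b = FreeAlgebra.ι K 0 * FreeAlgebra.ι K 1 + 1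

/-- The first Weyl algebra `A₁ = K⟨X, Y | YX - XY = 1⟩` over `K`,
realized as the quotient of the free algebra on two generators `X, Y`
by the relation `Y * X = X * Y + 1`. -/
abbrev WeylAlgebra (K : Type*) [CommRing K] := RingQuot (weylRel K)

namespace WeylAux
open Polynomial

noncomputable section

set_option linter.unusedSectionVars false

variable (K : Type*) [Field K]

def gX : WeylAlgebra K := RingQuot.mkAlgHom K (weylRel K) (FreeAlgebra.ι K 0)
def gY : WeylAlgebra K := RingQuot.mkAlgHom K (weylRel K) (FreeAlgebra.ι K 1)

lemma rel : gY K * gX K = gX K * gY K + 1 := by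
  have := RingQuot.mkAlgHom_rel K (s := weylRel K) (x := FreeAlgebra.ι K 1 * FreeAlgebra.ι K 0)
    (y := FreeAlgebra.ι K 0 * FreeAlgebra.ι K 1 + 1) ⟨rfl, rfl⟩
  simpa [gX, gY] using this

lemma ind (P : WeylAlgebra K → Prop) (hr : ∀ r, P (algebraMap K _ r)) (hX : P (gX K))
    (hY : P (gY K)) (hm : ∀ a b, P a → P b → P (a * b)) (ha : ∀ a b, P a → P b → P (a + b))
    (a : WeylAlgebra K) : P a := by
  obtain ⟨w, rfl⟩ := RingQuot.mkAlgHom_surjective K (weylRel K) a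
  induction w using FreeAlgebra.induction with
  | grade0 r => simpa using hr r
  | grade1 i => fin_cases i
                · exact hX
                · exact hY
  | mul a b h1 h2 => simpa using hm _ _ h1 h2
  | add a b h1 h2 => simpa using ha _ _ h1 h2

def oX : Module.End K (K[X][X]) :=
  LinearMap.mulLeft K (C X) - (derivative (R := K[X])).restrictScalars K
def oY : Module.End K (K[X][X]) := LinearMap.mulLeft K X

lemma oX_apply (p : K[X][X]) : oX K p = C X * p - derivative p := rfl
lemma oY_apply (p : K[X][X]) : oY K p = X * p := rfl

def rho : WeylAlgebra K →ₐ[K] Module.End K (K[X][X]) :=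
  RingQuot.liftAlgHom K ⟨FreeAlgebra.lift K ![oX K, oY K], by
    rintro _ _ ⟨rfl, rfl⟩
    ext1 p
    simp [oX_apply, oY_apply]
    ring⟩

lemma rho_X : rho K (gX K) = oX K := by simp [rho, gX]
lemma rho_Y : rho K (gY K) = oY K := by simp [rho, gY]

def tau (q : K[X][X]) : WeylAlgebra K := q.sum fun i f => gY K ^ i * aeval (gX K) f

lemma tau_add (p q : K[X][X]) : tau K (p + q) = tau K p + tau K q := by
  unfold tau
  rw [Polynomial.sum_add_index] <;> simp [mul_add]

lemma tau_mon (i : ℕ) (f : K[X]) : tau K (monomial i f) = gY K ^ i * aeval (gX K) f := by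
  unfold tau
  rw [Polynomial.sum_monomial_index]; simp

lemma tau_zero : tau K 0 = 0 := by simp [tau]

def tauH : K[X][X] →+ WeylAlgebra K := ⟨⟨tau K, tau_zero K⟩, tau_add K⟩

lemma tau_sub (p q : K[X][X]) : tau K (p - q) = tau K p - tau K q := map_sub (tauH K) p q

lemma X_mul_Y_pow (i : ℕ) : gX K * gY K ^ i = gY K ^ i * gX K - i * gY K ^ (i - 1) := by
  have h1 : gX K * gY K = gY K * gX K - 1 := by rw [rel]; abel
  induction i with
  | zero => simp
  | succ n ih =>
    rw [pow_succ, ← mul_assoc, ih, sub_mul, mul_assoc, h1, mul_assoc (n : WeylAlgebra K)]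
    rcases n with _ | n
    · simp
    · simp only [Nat.add_sub_cancel, ← pow_succ]
      push_cast
      rw [mul_sub, mul_one]
      noncomm_ring

lemma mul_tau (a : WeylAlgebra K) : ∀ p, a * tau K p = tau K (rho K a p) := by
  induction a using ind K with
  | hr r =>
    intro p
    induction p using Polynomial.induction_on' with
    | add p q hp hq => rw [tau_add, mul_add, hp, hq, map_add, tau_add]
    | monomial i f =>
      rw [AlgHom.commutes, Module.algebraMap_end_apply, smul_monomial, tau_mon, tau_mon,
        map_smul, ← Algebra.smul_def, mul_smul_comm]
  | hX =>
    intro p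
    induction p using Polynomial.induction_on' with
    | add p q hp hq => rw [tau_add, mul_add, hp, hq, map_add, tau_add]
    | monomial i f =>
      rw [rho_X, oX_apply, tau_sub, C_mul_monomial, derivative_monomial, tau_mon, tau_mon,
        tau_mon, ← mul_assoc, X_mul_Y_pow, map_mul (aeval (gX K)) X, aeval_X, sub_mul,
        mul_assoc, ← (Nat.cast_commute i f).eq, map_mul, map_natCast, ← mul_assoc (gY K ^ (i - 1)),
        (Nat.cast_commute i (gY K ^ (i - 1))).eq]
  | hY =>
    intro p
    induction p using Polynomial.induction_on' with
    | add p q hp hq => rw [tau_add, mul_add, hp, hq, map_add, tau_add]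
    | monomial i f =>
      rw [rho_Y, oY_apply, X_mul_monomial, tau_mon, tau_mon, pow_succ', mul_assoc]
  | hm a b h1 h2 => intro p; rw [mul_assoc, h2, h1, map_mul]; rfl
  | ha a b h1 h2 => intro p; rw [add_mul, h2, h1, ← tau_add, map_add]; rfl

def sig : WeylAlgebra K →ₗ[K] K[X][X] :=
  (LinearMap.applyₗ (1 : K[X][X])) ∘ₗ (rho K).toLinearMap

lemma sig_apply (a : WeylAlgebra K) : sig K a = rho K a 1 := rfl

lemma tau_sig (a : WeylAlgebra K) : tau K (sig K a) = a := by
  rw [sig_apply, ← mul_tau]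
  have : tau K 1 = 1 := by
    have := tau_mon K 0 1
    simpa using this
  rw [this, mul_one]

lemma sig_inj {a b : WeylAlgebra K} (h : sig K a = sig K b) : a = b := by
  rw [← tau_sig K a, h, tau_sig]

lemma sig_algebraMap (r : K) : sig K (algebraMap K _ r) = C (C r) := by
  rw [sig_apply, AlgHom.commutes, Module.algebraMap_end_apply, Algebra.smul_def, mul_one]; rfl

lemma sig_mul (a b : WeylAlgebra K) : sig K (a * b) = rho K a (sig K b) := by
  rw [sig_apply, map_mul]; rfl

lemma L_mon (k : ℕ) (r : K) (p : K[X][X]) : ∃ R : K[X][X],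
    (∀ j, p.natDegree < j + 2 → R.coeff j = 0) ∧
    aeval (oX K) (C r * X ^ k) p = C (C r * X ^ k) * p - C (derivative (C r * X ^ k)) * derivative p + R := by
  induction k with
  | zero =>
    refine ⟨0, by simp, ?_⟩
    simp [Algebra.smul_def]
  | succ k ih =>
    obtain ⟨R, hR, h⟩ := ih
    refine ⟨C X * R + C (derivative (C r * X ^ k)) * derivative (derivative p) - derivative R, ?_, ?_⟩
    · intro j hj
      simp only [coeff_sub, coeff_add, coeff_C_mul, coeff_derivative]
      rw [hR j hj, hR (j+1) (by omega), coeff_eq_zero_of_natDegree_lt (by omega : p.natDegree < j + 1 + 1)]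
      simp
    · have : (C r * X ^ (k+1) : K[X]) = X * (C r * X ^ k) := by ring
      rw [this, map_mul, aeval_X, Module.End.mul_apply, h, oX_apply]
      generalize (C r * X ^ k : K[X]) = f
      simp only [derivative_mul, derivative_X, map_add, map_mul, map_sub, derivative_C, map_one]
      ring

lemma L_gen (f : K[X]) (p : K[X][X]) : ∃ R : K[X][X],
    (∀ j, p.natDegree < j + 2 → R.coeff j = 0) ∧
    aeval (oX K) f p = C f * p - C (derivative f) * derivative p + R := by
  induction f using Polynomial.induction_on' with
  | add f g hf hg =>
    obtain ⟨R, hR, h⟩ := hf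
    obtain ⟨S, hS, h'⟩ := hg
    refine ⟨R + S, fun j hj => by simp [hR j hj, hS j hj], ?_⟩
    rw [map_add, LinearMap.add_apply, h, h']
    simp only [map_add]; ring
  | monomial k r => rw [← C_mul_X_pow_eq_monomial]; exact L_mon K k r p

lemma oY_pow (i : ℕ) (p : K[X][X]) : (oY K ^ i) p = X ^ i * p := by
  induction i with
  | zero => simp
  | succ n ih => rw [pow_succ', Module.End.mul_apply, ih, oY_apply]; ring

lemma rho_tau (m n : ℕ) (p : K[X][X]) (hp : p.natDegree ≤ n) (q : K[X][X]) (hq : q.natDegree ≤ m) :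
    ∀ k, m + n ≤ k + 1 → (rho K (tau K q) p).coeff k = (q * p).coeff k -
      (if k + 1 = m + n then n * derivative (q.coeff m) * p.coeff n else 0) := by
  refine Polynomial.induction_with_natDegree_le (fun q => ∀ k, m + n ≤ k + 1 → (rho K (tau K q) p).coeff k = (q * p).coeff k -
      (if k + 1 = m + n then n * derivative (q.coeff m) * p.coeff n else 0)) m ?_ ?_ ?_ q hq
  · simp [tau_zero]
  · intro i f hf him k hk
    obtain ⟨R, hR, h⟩ := L_gen K f p
    rw [C_mul_X_pow_eq_monomial, tau_mon, map_mul, map_pow, rho_Y, ← aeval_algHom_apply, rho_X,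
      Module.End.mul_apply, h, oY_pow, ← C_mul_X_pow_eq_monomial]
    rw [show (C f * X ^ i * p : K[X][X]) = X ^ i * (C f * p) by ring]
    rw [coeff_X_pow_mul', coeff_X_pow_mul']
    simp only [coeff_C_mul_X_pow]
    by_cases hik : i ≤ k
    · obtain ⟨l, rfl⟩ := Nat.exists_eq_add_of_le hik
      simp only [hik, if_true, Nat.add_sub_cancel_left, coeff_add, coeff_sub, coeff_C_mul, coeff_derivative]
      rw [hR l (by omega)]
      by_cases him' : m = i
      · subst him'
        by_cases hl : l + 1 = n
        · subst hl
          simp [add_assoc]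
          ring
        · rw [coeff_eq_zero_of_natDegree_lt (by omega : p.natDegree < l + 1), if_neg (by omega)]
          simp
      · rw [coeff_eq_zero_of_natDegree_lt (by omega : p.natDegree < l + 1), if_neg him']
        simp
    · have : n = 0 := by omega
      simp [hik, this]
  · intro f g hf hg h1 h2 k hk
    rw [tau_add, map_add, LinearMap.add_apply, coeff_add, h1 k hk, h2 k hk, add_mul, coeff_add, coeff_add, derivative_add]
    split_ifs <;> ring

lemma sig_mul_coeff {m n : ℕ} {a b : WeylAlgebra K} (ha : (sig K a).natDegree ≤ m)
    (hb : (sig K b).natDegree ≤ n) (k : ℕ) (hk : m + n ≤ k + 1) :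
    (sig K (a * b)).coeff k = (sig K a * sig K b).coeff k -
      (if k + 1 = m + n then n * derivative ((sig K a).coeff m) * (sig K b).coeff n else 0) := by
  have := rho_tau K m n _ hb _ ha k hk
  rwa [tau_sig, ← sig_mul] at this

lemma sig_mul_deg {m n : ℕ} {a b : WeylAlgebra K} (ha : (sig K a).natDegree ≤ m)
    (hb : (sig K b).natDegree ≤ n) : (sig K (a * b)).natDegree ≤ m + n := by
  rw [natDegree_le_iff_coeff_eq_zero]
  intro k hk
  rw [sig_mul_coeff K ha hb k (by omega), if_neg (by omega), coeff_eq_zero_of_natDegree_lt]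
  · simp
  · exact lt_of_le_of_lt (natDegree_mul_le_of_le ha hb) hk

lemma sig_mul_top {m n : ℕ} {a b : WeylAlgebra K} (ha : (sig K a).natDegree ≤ m)
    (hb : (sig K b).natDegree ≤ n) :
    (sig K (a * b)).coeff (m + n) = (sig K a).coeff m * (sig K b).coeff n := by
  rw [sig_mul_coeff K ha hb _ (by omega), if_neg (by omega), coeff_mul_add_eq_of_natDegree_le ha hb, sub_zero]

lemma sig_comm_top {m n k : ℕ} {a b : WeylAlgebra K} (ha : (sig K a).natDegree ≤ m)
    (hb : (sig K b).natDegree ≤ n) (hk : k + 1 = m + n) :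
    (sig K (a * b - b * a)).coeff k = m * (sig K a).coeff m * derivative ((sig K b).coeff n)
      - n * derivative ((sig K a).coeff m) * (sig K b).coeff n := by
  rw [map_sub, coeff_sub, sig_mul_coeff K ha hb _ hk.ge, sig_mul_coeff K hb ha _ (by omega),
    if_pos hk, if_pos (by omega), mul_comm (sig K b)]
  ring

lemma sig_comm_deg {m n : ℕ} {a b : WeylAlgebra K} (ha : (sig K a).natDegree ≤ m)
    (hb : (sig K b).natDegree ≤ n) :
    (sig K (a * b - b * a)).natDegree ≤ m + n := by
  rw [map_sub]
  exact natDegree_sub_le_of_le (sig_mul_deg K ha hb) (add_comm n m ▸ sig_mul_deg K hb ha) |>.trans (by simp)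

lemma sig_pow {m : ℕ} {a : WeylAlgebra K} (ha : (sig K a).natDegree ≤ m) (j : ℕ) :
    (sig K (a ^ j)).natDegree ≤ j * m ∧ (sig K (a ^ j)).coeff (j * m) = (sig K a).coeff m ^ j := by
  induction j with
  | zero =>
    have : sig K 1 = 1 := by simpa using sig_algebraMap K 1
    simp [this]
  | succ j ih =>
    rw [pow_succ, Nat.succ_mul]
    exact ⟨sig_mul_deg K ih.1 ha, by rw [sig_mul_top K ih.1 ha, ih.2, pow_succ]⟩

lemma gpow {A : Type*} [Ring A] (y c d : A) :
    y * (d * c) - (d * c) * y = (y * d - d * y) * c + d * (y * c - c * y) := by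
  noncomm_ring

lemma gneg {A : Type*} [Ring A] (x y : A) : -x * y - y * -x = y * x - x * y := by
  rw [neg_mul, mul_neg]; abel

lemma gsmul {A : Type*} [Ring A] [Algebra K A] (r : K) (y p : A) :
    y * (r • p) - (r • p) * y = r • (y * p - p * y) := by
  rw [mul_smul_comm, smul_mul_assoc, smul_sub]

variable [CharZero K]

lemma wr_deg {u v : K[X]} (hu : u ≠ 0) (hv : v ≠ 0) (h : derivative u * v = u * derivative v) :
    u.natDegree = v.natDegree := by
  have key : ∀ w : K[X], (X * derivative w).natDegree ≤ w.natDegree ∧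
      (X * derivative w).coeff w.natDegree = w.natDegree * w.leadingCoeff := by
    intro w
    have hc : ∀ k, (X * derivative w).coeff k = k * w.coeff k := by
      intro k
      cases k with
      | zero => simp
      | succ k => rw [coeff_X_mul, coeff_derivative]; push_cast; ring
    refine ⟨?_, hc _⟩
    rw [natDegree_le_iff_coeff_eq_zero]
    intro k hk
    rw [hc, coeff_eq_zero_of_natDegree_lt hk, mul_zero]
  have h2 : (X * derivative u) * v = u * (X * derivative v) := by
    rw [mul_assoc, h]; ring
  have h3 := congrArg (fun p => coeff p (u.natDegree + v.natDegree)) h2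
  beta_reduce at h3
  rw [coeff_mul_add_eq_of_natDegree_le (key u).1 le_rfl, coeff_mul_add_eq_of_natDegree_le le_rfl (key v).1,
    (key u).2, (key v).2] at h3
  have hu' := leadingCoeff_ne_zero.2 hu
  have hv' := leadingCoeff_ne_zero.2 hv
  simp only [coeff_natDegree] at h3
  have h4 : (u.natDegree : K) = v.natDegree := by
    apply mul_right_cancel₀ (mul_ne_zero hu' hv')
    linear_combination h3
  exact_mod_cast h4

lemma wr {u v : K[X]} (hu : u ≠ 0) (hv : v ≠ 0) (h : derivative u * v = u * derivative v) :
    ∃ l : K, u = C l * v := by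
  refine ⟨u.leadingCoeff / v.leadingCoeff, ?_⟩
  have hv' := leadingCoeff_ne_zero.2 hv
  have hd := wr_deg K hu hv h
  by_contra hne
  set l := u.leadingCoeff / v.leadingCoeff with hl
  have hw : u - C l * v ≠ 0 := sub_ne_zero.2 hne
  have hd' := wr_deg K hw hv (by
    simp only [derivative_sub, derivative_mul, derivative_C]
    linear_combination h)
  apply leadingCoeff_ne_zero.2 hw
  rw [leadingCoeff, hd', coeff_sub, coeff_C_mul, ← hd, coeff_natDegree, hd, coeff_natDegree, hl]
  field_simp
  simp

lemma comm_lead {x c : WeylAlgebra K} (h : x * c = c * x) :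
    ((sig K c).natDegree : K[X]) * (sig K c).leadingCoeff * derivative (sig K x).leadingCoeff =
    ((sig K x).natDegree : K[X]) * derivative (sig K c).leadingCoeff * (sig K x).leadingCoeff := by
  rcases Nat.eq_zero_or_pos ((sig K c).natDegree + (sig K x).natDegree) with h0 | h0
  · have h1 : (sig K c).natDegree = 0 := by omega
    have h2 : (sig K x).natDegree = 0 := by omega
    simp [h1, h2]
  · have := sig_comm_top K (a := c) (b := x) le_rfl le_rfl (Nat.sub_add_cancel h0)
    rw [h, sub_self, map_zero, coeff_zero] at this
    exact (sub_eq_zero.1 this.symm)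

lemma sig_ne {c : WeylAlgebra K} (h : c ≠ 0) : sig K c ≠ 0 := fun h' =>
  h (sig_inj K (by rw [h', map_zero]))

lemma of_deg_zero {c : WeylAlgebra K} (h : (sig K c).natDegree = 0) :
    c = aeval (gX K) (sig K c).leadingCoeff := by
  have h1 := tau_sig K c
  rw [eq_C_of_natDegree_eq_zero h, ← monomial_zero_left, tau_mon] at h1
  have h2 : (sig K c).leadingCoeff = (sig K c).coeff 0 := by rw [leadingCoeff, h]
  rw [h2]
  simpa using h1.symm

lemma structQ {x c : WeylAlgebra K} (h : x * c = c * x) (hn : 0 < (sig K x).natDegree) :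
    (∃ r, c = algebraMap K _ r) ∨ (0 < (sig K c).natDegree ∧ ∃ l : K, l ≠ 0 ∧
      (sig K (c ^ (sig K x).natDegree - l • x ^ (sig K c).natDegree)).natDegree <
        (sig K x).natDegree * (sig K c).natDegree) := by
  by_cases hc : c = 0
  · exact Or.inl ⟨0, by simp [hc]⟩
  have hx : sig K x ≠ 0 := by rintro h; simp [h] at hn
  have hw := comm_lead K h
  have hpc := sig_pow K (a := c) le_rfl (sig K x).natDegree
  have hpx := sig_pow K (a := x) le_rfl (sig K c).natDegree
  have hf := leadingCoeff_ne_zero.2 (sig_ne K hc)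
  have hg := leadingCoeff_ne_zero.2 hx
  rw [coeff_natDegree] at hpc hpx
  set n := (sig K x).natDegree with hnn
  set m := (sig K c).natDegree with hm
  set f := (sig K c).leadingCoeff with hff
  set g := (sig K x).leadingCoeff
  obtain ⟨l, hl⟩ := wr K (u := f ^ n) (v := g ^ m) (pow_ne_zero _ hf) (pow_ne_zero _ hg) (by
    obtain ⟨n', hn'⟩ := Nat.exists_eq_add_of_lt hn
    rw [zero_add] at hn'
    rw [hn'] at hw ⊢
    cases hm : m with
    | zero =>
      rw [hm] at hw
      simp only [Nat.cast_zero, zero_mul] at hw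
      have : derivative f = 0 := by
        have h1 : ((n' + 1 : ℕ) : K[X]) ≠ 0 := Nat.cast_ne_zero.2 (by omega)
        simpa [h1, hg, -Nat.cast_add, -Nat.cast_succ] using hw.symm
      simp [derivative_pow, this]
    | succ m' =>
      rw [hm] at hw
      simp only [derivative_pow, Nat.add_sub_cancel, map_natCast]
      linear_combination (-f^n' * g^m') * hw)
  have hl0 : l ≠ 0 := by
    rintro rfl
    rw [C_0, zero_mul] at hl
    exact pow_ne_zero _ hf hl
  rcases Nat.eq_zero_or_pos m with hm0 | hm0
  · left
    rw [hm0, pow_zero, mul_one] at hl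
    have h1 : f.natDegree = 0 := by
      have := congrArg natDegree hl
      rw [natDegree_pow, natDegree_C] at this
      rcases Nat.mul_eq_zero.1 this with h | h
      · omega
      · exact h
    refine ⟨f.coeff 0, ?_⟩
    have h2 := of_deg_zero K (hm ▸ hm0)
    rw [← hff, eq_C_of_natDegree_eq_zero h1, aeval_C] at h2
    exact h2
  · right
    refine ⟨hm0, l, hl0, ?_⟩
    refine lt_of_le_of_ne ?_ ?_
    · rw [map_sub, map_smul]
      refine (natDegree_sub_le_of_le hpc.1 ((natDegree_smul_le _ _).trans hpx.1)).trans ?_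
      rw [mul_comm m n]; simp
    · intro he
      have hz : (sig K (c ^ n - l • x ^ m)).coeff (n * m) = 0 := by
        rw [map_sub, map_smul, coeff_sub, coeff_smul, hpc.2, mul_comm n m, hpx.2, hl, smul_eq_C_mul, sub_self]
      rw [← he, coeff_natDegree, leadingCoeff_eq_zero] at hz
      rw [hz, natDegree_zero] at he
      have := Nat.mul_pos hn hm0
      omega

lemma dpow {y c : WeylAlgebra K} {m e : ℕ} (hc : (sig K c).natDegree ≤ m)
    (hd : (sig K (y * c - c * y)).natDegree ≤ e) (j : ℕ) :
    (sig K (y * c ^ (j+1) - c ^ (j+1) * y)).natDegree ≤ j * m + e ∧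
    (sig K (y * c ^ (j+1) - c ^ (j+1) * y)).coeff (j * m + e) =
      ((j + 1 : ℕ) : K[X]) * (sig K c).coeff m ^ j * (sig K (y * c - c * y)).coeff e := by
  induction j with
  | zero => simpa using hd
  | succ j ih =>
    have h : y * c ^ (j+1+1) - c ^ (j+1+1) * y =
        (y * c ^ (j+1) - c ^ (j+1) * y) * c + c ^ (j+1) * (y * c - c * y) := by
      rw [pow_succ c (j+1)]; exact gpow _ _ _
    have hp := sig_pow K hc (j+1)
    have e1 : (j+1) * m + e = (j * m + e) + m := by ring
    have d1 := sig_mul_deg K ih.1 hc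
    have d2 := sig_mul_deg K hp.1 hd
    have t1 := sig_mul_top K ih.1 hc
    have t2 := sig_mul_top K hp.1 hd
    rw [h, map_add]
    constructor
    · refine (natDegree_add_le_of_le (e1 ▸ d1) d2).trans (by simp)
    · rw [coeff_add, t2, e1, t1, ih.2, hp.2]
      push_cast
      ring

lemma dx {x y : WeylAlgebra K} (h : y * x - x * y = 1) (j : ℕ) :
    y * x ^ (j+1) - x ^ (j+1) * y = ((j + 1 : ℕ) : K) • x ^ j := by
  induction j with
  | zero => simpa using h
  | succ j ih =>
    have h' : y * x ^ (j+1+1) - x ^ (j+1+1) * y =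
        (y * x ^ (j+1) - x ^ (j+1) * y) * x + x ^ (j+1) * (y * x - x * y) := by
      rw [pow_succ x (j+1)]; exact gpow _ _ _
    rw [h', ih, h, smul_mul_assoc, ← pow_succ, mul_one, Nat.cast_succ (j+1), add_smul, one_smul]

lemma dcomm {x y c : WeylAlgebra K} (h : y * x - x * y = 1) (hc : x * c = c * x) :
    x * (y * c - c * y) = (y * c - c * y) * x := by
  have h1 : y * x = x * y + 1 := by rw [← h]; abel
  have e1 : x * y = y * x - 1 := by rw [h1]; abel
  rw [mul_sub, sub_mul, ← mul_assoc, ← mul_assoc, e1, hc, sub_mul, mul_assoc y x c, hc,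
    mul_assoc c x y, mul_assoc c y x, h1, mul_add]
  noncomm_ring

lemma rcomm {x c : WeylAlgebra K} (hc : x * c = c * x) (n m : ℕ) (l : K) :
    x * (c ^ n - l • x ^ m) = (c ^ n - l • x ^ m) * x := by
  have h1 : Commute x c := hc
  exact ((h1.pow_right n).sub_right (((Commute.refl x).pow_right m).smul_right l)).eq

lemma Dsplit (y a b : WeylAlgebra K) (l : K) :
    y * a - a * y = l • (y * b - b * y) + (y * (a - l • b) - (a - l • b) * y) := by
  simp only [mul_sub, sub_mul, smul_sub, mul_smul_comm, smul_mul_assoc]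
  abel

lemma descent {x y : WeylAlgebra K} (h : y * x - x * y = 1) (hn : 0 < (sig K x).natDegree)
    (N : ℕ)
    (hN : ∀ c, x * c = c * x → ∀ k, (sig K c).natDegree + (N + 1) < k + (sig K x).natDegree →
      (sig K (y * c - c * y)).coeff k = 0) :
    ∀ c, x * c = c * x → ∀ k, (sig K c).natDegree + N < k + (sig K x).natDegree →
      (sig K (y * c - c * y)).coeff k = 0 := by
  intro c hc k hk
  by_cases hk' : (sig K c).natDegree + (N + 1) < k + (sig K x).natDegree
  · exact hN c hc k hk'
  rcases structQ K hc hn with ⟨r, rfl⟩ | ⟨hm, l, hl, hr⟩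
  · rw [Algebra.commutes r y, sub_self]; simp
  have hkd : (sig K (y * c - c * y)).natDegree ≤ k := by
    rw [natDegree_le_iff_coeff_eq_zero]
    intro j hj
    exact hN c hc j (by omega)
  have hf : (sig K c).leadingCoeff ≠ 0 := by
    intro h0
    rw [leadingCoeff_eq_zero] at h0
    simp [h0] at hm
  have hrN := hN _ (rcomm K hc (sig K x).natDegree (sig K c).natDegree l)
  have hsp := Dsplit K y (c ^ (sig K x).natDegree) (x ^ (sig K c).natDegree) l
  set n := (sig K x).natDegree with hnn
  set m := (sig K c).natDegree with hmm
  obtain ⟨n', hn'⟩ : ∃ n', n = n' + 1 := ⟨n - 1, by omega⟩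
  obtain ⟨m', hm'⟩ : ∃ m', m = m' + 1 := ⟨m - 1, by omega⟩
  have hdp := (dpow K (le_refl m) hkd n').2
  have e1 : n' * m + k + n = n * m + N + 1 := by
    have : n * m = n' * m + m := by rw [hn']; ring
    omega
  have z1 := hrN (n' * m + k) (by omega)
  have z2 : (sig K (x ^ m')).coeff (n' * m + k) = 0 := by
    apply coeff_eq_zero_of_natDegree_lt
    refine lt_of_le_of_lt (sig_pow K (le_refl n) m').1 ?_
    have : n * m = m' * n + n := by rw [hm']; ring
    omega
  have hdx := dx K h m'
  rw [← hm'] at hdx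
  rw [hdx] at hsp
  rw [← hn', hsp, map_add, coeff_add, z1, map_smul, map_smul, coeff_smul, coeff_smul, z2] at hdp
  simp only [smul_zero, add_zero] at hdp
  have hnz : (n : K[X]) ≠ 0 := Nat.cast_ne_zero.2 (by omega)
  rcases mul_eq_zero.1 hdp.symm with h1 | h1
  · exact absurd h1 (mul_ne_zero hnz (pow_ne_zero _ hf))
  · exact h1

lemma descent0 {x y : WeylAlgebra K} (h : y * x - x * y = 1) (hn : 0 < (sig K x).natDegree) :
    ∀ c, x * c = c * x → ∀ k, (sig K c).natDegree < k + (sig K x).natDegree →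
      (sig K (y * c - c * y)).coeff k = 0 := by
  have key : ∀ M N : ℕ, N + M = (sig K y).natDegree + (sig K x).natDegree →
      ∀ c, x * c = c * x → ∀ k, (sig K c).natDegree + N < k + (sig K x).natDegree →
      (sig K (y * c - c * y)).coeff k = 0 := by
    intro M
    induction M with
    | zero =>
      intro N hN c hc k hk
      apply coeff_eq_zero_of_natDegree_lt
      refine lt_of_le_of_lt (sig_comm_deg K le_rfl le_rfl) ?_
      omega
    | succ M ih =>
      intro N hN
      exact descent K h hn N (ih (N+1) (by omega))
  exact key ((sig K y).natDegree + (sig K x).natDegree) 0 (by omega)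

lemma ker_scalar {x y : WeylAlgebra K} (h : y * x - x * y = 1) (hn : 0 < (sig K x).natDegree)
    {c : WeylAlgebra K} (hc : x * c = c * x) (hy : y * c = c * y) : ∃ r, c = algebraMap K _ r := by
  rcases structQ K hc hn with hr | ⟨hm, l, hl, hr⟩
  · exact hr
  exfalso
  have hrN := descent0 K h hn _ (rcomm K hc (sig K x).natDegree (sig K c).natDegree l)
  have hsp := Dsplit K y (c ^ (sig K x).natDegree) (x ^ (sig K c).natDegree) l
  have hg : (sig K x).leadingCoeff ≠ 0 := by
    intro h0
    rw [leadingCoeff_eq_zero] at h0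
    simp [h0] at hn
  set n := (sig K x).natDegree with hnn
  set m := (sig K c).natDegree with hmm
  obtain ⟨m', hm'⟩ : ∃ m', m = m' + 1 := ⟨m - 1, by omega⟩
  have hdx := dx K h m'
  rw [← hm'] at hdx
  have hcn : y * c ^ n = c ^ n * y := (Commute.pow_right (hy : Commute y c) n).eq
  have z1 := hrN (m' * n) (by
    have : n * m = m' * n + n := by rw [hm']; ring
    omega)
  have z2 := (sig_pow K (le_refl n) m').2
  have := congrArg (fun a => (sig K a).coeff (m' * n)) hsp
  beta_reduce at this
  rw [hcn, sub_self, hdx, map_add, coeff_add, z1, map_smul, map_smul, coeff_smul, coeff_smul, z2,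
    map_zero, coeff_zero, add_zero] at this
  have hmz : (m : K) ≠ 0 := Nat.cast_ne_zero.2 (by omega)
  have h3 := this.symm
  rw [smul_eq_zero, smul_eq_zero] at h3
  rcases h3 with h3 | h3 | h3
  · exact hl h3
  · exact hmz h3
  · exact pow_ne_zero _ hg h3

lemma integ {x y : WeylAlgebra K} (h : y * x - x * y = 1) {q : WeylAlgebra K}
    (hq : q ∈ Algebra.adjoin K ({x} : Set (WeylAlgebra K))) :
    ∃ p ∈ Algebra.adjoin K ({x} : Set (WeylAlgebra K)), y * p - p * y = q := by
  rw [Algebra.adjoin_singleton_eq_range_aeval] at hq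
  obtain ⟨P, rfl⟩ := hq
  have hx : x ∈ Algebra.adjoin K ({x} : Set (WeylAlgebra K)) := Algebra.self_mem_adjoin_singleton K x
  change ∃ p ∈ Algebra.adjoin K ({x} : Set (WeylAlgebra K)), y * p - p * y = aeval x P
  induction P using Polynomial.induction_on' with
  | add P Q hP hQ =>
    obtain ⟨p, hp, hp'⟩ := hP
    obtain ⟨q, hq, hq'⟩ := hQ
    refine ⟨p + q, add_mem hp hq, ?_⟩
    rw [map_add, ← hp', ← hq']
    noncomm_ring
  | monomial k r =>
    refine ⟨(r / ((k + 1 : ℕ) : K)) • x ^ (k+1), Subalgebra.smul_mem _ (pow_mem hx _) _, ?_⟩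
    have hk : ((k + 1 : ℕ) : K) ≠ 0 := Nat.cast_ne_zero.2 (by omega)
    refine (gsmul K (r / ((k + 1 : ℕ) : K)) y (x ^ (k+1))).trans ?_
    rw [dx K h, smul_smul, div_mul_cancel₀ _ hk,
      aeval_monomial, Algebra.smul_def]

lemma comm_adjoin {x q : WeylAlgebra K}
    (hq : q ∈ Algebra.adjoin K ({x} : Set (WeylAlgebra K))) : x * q = q * x := by
  rw [Algebra.adjoin_singleton_eq_range_aeval] at hq
  obtain ⟨P, rfl⟩ := hq
  change x * aeval x P = aeval x P * x
  have h1 : aeval x (X * P) = aeval x (P * X) := by rw [mul_comm]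
  simpa using h1

lemma centr_zero {x y : WeylAlgebra K} (h : y * x - x * y = 1) (hn : (sig K x).natDegree = 0)
    {c : WeylAlgebra K} (hc : x * c = c * x) :
    c ∈ Algebra.adjoin K ({x} : Set (WeylAlgebra K)) := by
  have hx := of_deg_zero K hn
  have s1 : sig K (1 : WeylAlgebra K) = 1 := by simpa using sig_algebraMap K 1
  have h10 : (1 : WeylAlgebra K) ≠ 0 := by
    intro h
    rw [h, map_zero] at s1
    exact zero_ne_one s1
  have hw := comm_lead K hc
  set g := (sig K x).leadingCoeff with hg
  have hg' : derivative g ≠ 0 := by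
    intro h0
    have := derivative_eq_zero.1 h0
    rw [eq_C_of_natDegree_eq_zero this, aeval_C] at hx
    rw [hx, Algebra.commutes, sub_self] at h
    exact h10 h.symm
  have hl : 0 < (sig K y).natDegree := by
    by_contra hl
    have hy := of_deg_zero K (by omega : (sig K y).natDegree = 0)
    rw [hx, hy, ← map_mul, ← map_mul, mul_comm, sub_self] at h
    exact h10 h.symm
  have hy0 : (sig K y).leadingCoeff ≠ 0 := by
    intro h0
    rw [leadingCoeff_eq_zero] at h0
    simp [h0] at hl
  have ht := sig_comm_top K (a := y) (b := x) le_rfl hn.le (Nat.sub_add_cancel hl)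
  have hxc : (sig K x).coeff 0 = g := by rw [hg, leadingCoeff, hn]
  rw [h, s1, coeff_one, coeff_natDegree, hxc, Nat.cast_zero, zero_mul, zero_mul, sub_zero] at ht
  have hnz : ((sig K y).natDegree : K[X]) ≠ 0 := Nat.cast_ne_zero.2 (by omega)
  have hne := mul_ne_zero (mul_ne_zero hnz hy0) hg'
  split_ifs at ht with hl1
  swap
  · exact absurd ht.symm hne
  have hu : IsUnit (derivative g) := IsUnit.of_mul_eq_one _ ((mul_comm _ _).trans ht.symm)
  obtain ⟨α, hα, hgα⟩ := Polynomial.isUnit_iff.1 hu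
  have hα0 := hα.ne_zero
  have h0 : derivative (g - C α * X) = 0 := by simp [← hgα]
  have h2 := eq_C_of_natDegree_eq_zero (derivative_eq_zero.1 h0)
  set β := (g - C α * X).coeff 0
  have h3 : g = C α * X + C β := by rw [← h2]; ring
  rw [h3] at hx
  simp only [map_add, map_mul, aeval_C, aeval_X] at hx
  have hX : gX K = α⁻¹ • (x - algebraMap K _ β) := by
    rw [hx, add_sub_cancel_right, ← Algebra.smul_def, smul_smul, inv_mul_cancel₀ hα0, one_smul]
  have hmem : gX K ∈ Algebra.adjoin K ({x} : Set (WeylAlgebra K)) := by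
    rw [hX]
    exact Subalgebra.smul_mem _ (sub_mem (Algebra.self_mem_adjoin_singleton K x)
      (Subalgebra.algebraMap_mem _ _)) _
  by_cases hc0 : c = 0
  · rw [hc0]; exact zero_mem _
  rw [hn, Nat.cast_zero, zero_mul, zero_mul] at hw
  have hcd : (sig K c).natDegree = 0 := by
    have h5 := leadingCoeff_ne_zero.2 (sig_ne K hc0)
    by_contra h6
    have h7 : ((sig K c).natDegree : K[X]) ≠ 0 := Nat.cast_ne_zero.2 h6
    exact mul_ne_zero (mul_ne_zero h7 h5) hg' hw
  rw [of_deg_zero K hcd]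
  have h8 : aeval (gX K) (sig K c).leadingCoeff ∈ Algebra.adjoin K ({gX K} : Set (WeylAlgebra K)) :=
    aeval_mem_adjoin_singleton K _
  exact Algebra.adjoin_le (Set.singleton_subset_iff.2 hmem) h8

lemma centr {x y : WeylAlgebra K} (h : y * x - x * y = 1) (c : WeylAlgebra K) (hc : x * c = c * x) :
    c ∈ Algebra.adjoin K ({x} : Set (WeylAlgebra K)) := by
  rcases Nat.eq_zero_or_pos (sig K x).natDegree with hn | hn
  · exact centr_zero K h hn hc
  induction hd : (sig K c).natDegree using Nat.strong_induction_on generalizing c with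
  | _ d ih =>
    have hD : y * c - c * y ∈ Algebra.adjoin K ({x} : Set (WeylAlgebra K)) := by
      by_cases h0 : y * c - c * y = 0
      · rw [h0]; exact zero_mem _
      · refine ih _ ?_ _ (dcomm K h hc) rfl
        by_contra hlt
        have := descent0 K h hn c hc (sig K (y * c - c * y)).natDegree (by omega)
        rw [coeff_natDegree, leadingCoeff_eq_zero] at this
        exact sig_ne K h0 this
    obtain ⟨p, hp, hp'⟩ := integ K h hD
    have hpx := comm_adjoin K hp
    obtain ⟨r, hr⟩ := ker_scalar K h hn (c := c - p) (by rw [mul_sub, sub_mul, hc, hpx]) (by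
      rw [mul_sub, sub_mul, sub_eq_sub_iff_sub_eq_sub]
      exact hp'.symm)
    rw [← sub_add_cancel c p, hr]
    exact add_mem (Subalgebra.algebraMap_mem _ _) hp

end

end WeylAux

/-- **Proposition 2.8.(2).** If `[y,x] = 1` for elements `x, y` of the Weyl algebra `A₁`
over a field `K` of characteristic zero, and `δ := ad(x) ∘ ad(y)` (so
`δ(a) = [x, [y, a]]`), then `ker δ = K[x] + K[y]`, the sum of the polynomial subalgebras
generated by `x` and by `y`. -/
theorem ker_comp_eq_sum (K : Type*) [Field K] [CharZero K]
    (x y : WeylAlgebra K) (hxy : y * x - x * y = 1) (a : WeylAlgebra K) :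
    x * (y * a - a * y) - (y * a - a * y) * x = 0
    ↔ ∃ p ∈ Algebra.adjoin K ({x} : Set (WeylAlgebra K)),
        ∃ q ∈ Algebra.adjoin K ({y} : Set (WeylAlgebra K)), a = p + q := by
  constructor
  · intro h
    have h1 := WeylAux.centr K hxy _ (sub_eq_zero.1 h)
    obtain ⟨p, hp, hp'⟩ := WeylAux.integ K hxy h1
    refine ⟨p, hp, a - p, ?_, by abel⟩
    refine WeylAux.centr K (x := y) (y := -x) ((WeylAux.gneg x y).trans hxy) _ ?_
    rw [mul_sub, sub_mul, sub_eq_sub_iff_sub_eq_sub]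
    exact hp'.symm
  · rintro ⟨p, hp, q, hq, rfl⟩
    have h1 := WeylAux.comm_adjoin K hp
    have h2 := WeylAux.comm_adjoin K hq
    have h3 := WeylAux.dcomm K hxy h1
    have h4 : y * (p + q) - (p + q) * y = y * p - p * y := by rw [mul_add, add_mul, h2]; abel
    rw [h4, h3, sub_self]
end

section
/- Suppose [y,x] = 1 for elements x, y of the first Weyl algebra A₁ over a field K of characteristic zero; let A₁' := K⟨x,y⟩, h := yx, and δ := ad(x)∘ad(y). Then: (1) C(h) ∩ A₁' = K[h]; (2) C(h) = K[h] if and only if the map δ (which maps C(h) into C(h)) acts locally nilpotently on C(h). -/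
set_option linter.unusedSectionVars false

section gen
variable {K A : Type*} [Field K] [CharZero K] [Ring A] [Algebra K A]

lemma wy_pow {x y : A} (h : y * x = x * y + 1) (n : ℕ) :
    y * x ^ (n+1) = x ^ (n+1) * y + (n+1 : ℕ) * x ^ n := by
  induction n with
  | zero => simp [h]
  | succ n ih =>
    rw [pow_succ x (n+1), ← mul_assoc, ih, add_mul, mul_assoc _ y x, h, mul_add, mul_one,
      mul_assoc _ (x^n) x, ← pow_succ]
    push_cast
    noncomm_ring

lemma wy_pow' {x y : A} (h : y * x = x * y + 1) (n : ℕ) :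
    y ^ (n+1) * x = x * y ^ (n+1) + (n+1 : ℕ) * y ^ n := by
  induction n with
  | zero => simp [h]
  | succ n ih =>
    rw [pow_succ' y (n+1), mul_assoc, ih, mul_add, ← mul_assoc y x, h, add_mul, one_mul,
      (Nat.cast_commute (n+1) (y^n)).eq, ← mul_assoc, ← pow_succ',
      ← (Nat.cast_commute (n+1) (y^(n+1))).eq]
    push_cast
    noncomm_ring

/-- spanning box -/
lemma wy_box {x y : A} (h : y * x = x * y + 1) (n : ℕ) (a : A)
    (ha : a ∈ Submodule.span K {a | ∃ i j, i ≤ n ∧ j ≤ n ∧ a = x ^ i * y ^ j}) :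
    x * a ∈ Submodule.span K {a | ∃ i j, i ≤ n+1 ∧ j ≤ n+1 ∧ a = x ^ i * y ^ j} ∧
    y * a ∈ Submodule.span K {a | ∃ i j, i ≤ n+1 ∧ j ≤ n+1 ∧ a = x ^ i * y ^ j} := by
  induction ha using Submodule.span_induction with
  | mem a ha =>
    obtain ⟨i, j, hi, hj, rfl⟩ := ha
    constructor
    · exact Submodule.subset_span ⟨i+1, j, by omega, by omega, by rw [pow_succ', mul_assoc]⟩
    · cases i with
      | zero => exact Submodule.subset_span ⟨0, j+1, by omega, by omega, by simp [pow_succ']⟩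
      | succ i =>
        rw [← mul_assoc, wy_pow h, add_mul, mul_assoc, ← pow_succ', mul_assoc]
        refine add_mem (Submodule.subset_span ⟨i+1, j+1, by omega, by omega, rfl⟩) ?_
        rw [← nsmul_eq_mul]
        have : x ^ i * y ^ j ∈ Submodule.span K
            {a | ∃ i j, i ≤ n+1 ∧ j ≤ n+1 ∧ a = x ^ i * y ^ j} :=
          Submodule.subset_span ⟨i, j, by omega, by omega, rfl⟩
        exact nsmul_mem this _
  | zero => simp
  | add a b _ _ ha hb =>
    rw [mul_add, mul_add]; exact ⟨add_mem ha.1 hb.1, add_mem ha.2 hb.2⟩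
  | smul k a _ ha =>
    rw [mul_smul_comm, mul_smul_comm]
    exact ⟨Submodule.smul_mem _ _ ha.1, Submodule.smul_mem _ _ ha.2⟩

lemma wy_span {x y : A} (h : y * x = x * y + 1) (a : A)
    (ha : a ∈ Algebra.adjoin K {x, y}) :
    ∃ n, a ∈ Submodule.span K {a | ∃ i j, i ≤ n ∧ j ≤ n ∧ a = x ^ i * y ^ j} := by
  have mono : ∀ m n : ℕ, m ≤ n →
      Submodule.span K {a | ∃ i j, i ≤ m ∧ j ≤ m ∧ a = x ^ i * y ^ j} ≤
      Submodule.span K {a | ∃ i j, i ≤ n ∧ j ≤ n ∧ a = x ^ i * y ^ j} := by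
    intro m n hmn
    apply Submodule.span_mono
    rintro _ ⟨i, j, hi, hj, rfl⟩
    exact ⟨i, j, by omega, by omega, rfl⟩
  suffices H : ∀ b, (∃ n, b ∈ Submodule.span K {a | ∃ i j, i ≤ n ∧ j ≤ n ∧ a = x ^ i * y ^ j}) →
      ∃ n, a * b ∈ Submodule.span K {a | ∃ i j, i ≤ n ∧ j ≤ n ∧ a = x ^ i * y ^ j} by
    simpa using H 1 ⟨0, Submodule.subset_span ⟨0, 0, by simp⟩⟩
  induction ha using Algebra.adjoin_induction with
  | mem a ha =>
    rintro b ⟨n, hn⟩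
    rcases ha with rfl | rfl
    · exact ⟨n+1, (wy_box h n b hn).1⟩
    · exact ⟨n+1, (wy_box h n b hn).2⟩
  | algebraMap r =>
    rintro b ⟨n, hn⟩
    exact ⟨n, by rw [← Algebra.smul_def]; exact Submodule.smul_mem _ _ hn⟩
  | add a c _ _ ha hc =>
    intro b hb
    obtain ⟨n, hn⟩ := ha b hb
    obtain ⟨m, hm⟩ := hc b hb
    exact ⟨max n m, by
      rw [add_mul]
      exact add_mem (mono _ _ (le_max_left _ _) hn) (mono _ _ (le_max_right _ _) hm)⟩
  | mul a c _ _ ha hc =>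
    intro b hb
    rw [mul_assoc]
    exact ha _ (hc b hb)

lemma wy_xyh {x y : A} (h : y * x = x * y + 1) (n : ℕ) :
    x ^ n * y ^ n * (y * x) = x ^ (n+1) * y ^ (n+1) + (n+1 : ℕ) • (x ^ n * y ^ n) := by
  rw [mul_assoc, ← mul_assoc _ y x, ← pow_succ, wy_pow' h, mul_add, ← mul_assoc, ← pow_succ,
    ← nsmul_eq_mul, mul_smul_comm]

lemma wy_b_mem {x y : A} (h : y * x = x * y + 1) (n : ℕ) :
    x ^ n * y ^ n ∈ Algebra.adjoin K {y * x} := by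
  induction n with
  | zero => simp
  | succ n ih =>
    have := wy_xyh h n
    rw [← sub_eq_iff_eq_add] at this
    rw [← this]
    exact sub_mem (mul_mem ih (Algebra.self_mem_adjoin_singleton K _)) (nsmul_mem ih _)

lemma wy_adjoin_span {x y : A} (h : y * x = x * y + 1) (a : A)
    (ha : a ∈ Algebra.adjoin K {y * x}) :
    a ∈ Submodule.span K (Set.range fun n : ℕ => x ^ n * y ^ n) := by
  suffices H : ∀ b ∈ Submodule.span K (Set.range fun n : ℕ => x ^ n * y ^ n),
      b * a ∈ Submodule.span K (Set.range fun n : ℕ => x ^ n * y ^ n) by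
    simpa using H 1 (Submodule.subset_span ⟨0, by simp⟩)
  induction ha using Algebra.adjoin_induction with
  | mem a ha =>
    rw [Set.mem_singleton_iff] at ha
    subst ha
    intro b hb
    induction hb using Submodule.span_induction with
    | mem b hb =>
      obtain ⟨n, rfl⟩ := hb
      simp only
      rw [wy_xyh h]
      have : x ^ n * y ^ n ∈ Submodule.span K (Set.range fun n : ℕ => x ^ n * y ^ n) :=
        Submodule.subset_span ⟨n, rfl⟩
      exact add_mem (Submodule.subset_span ⟨n+1, rfl⟩) (nsmul_mem this _)
    | zero => simp
    | add a b _ _ ha hb => rw [add_mul]; exact add_mem ha hb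
    | smul k a _ ha => rw [smul_mul_assoc]; exact Submodule.smul_mem _ _ ha
  | algebraMap r =>
    intro b hb
    rw [← Algebra.commutes, ← Algebra.smul_def]; exact Submodule.smul_mem _ _ hb
  | add a c _ _ ha hc => intro b hb; rw [mul_add]; exact add_mem (ha b hb) (hc b hb)
  | mul a c _ _ ha hc => intro b hb; rw [← mul_assoc]; exact hc _ (ha b hb)

variable (K) in
def wyAd (a : A) : A →ₗ[K] A := LinearMap.mulLeft K a - LinearMap.mulRight K a

lemma wyAd_apply (a b : A) : wyAd K a b = a * b - b * a := by simp [wyAd]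

lemma wy_weight {x y : A} (h : y * x = x * y + 1) (i j : ℕ) :
    wyAd K (y * x) (x ^ i * y ^ j) = ((i : K) - j) • (x ^ i * y ^ j) := by
  have h1 : ∀ i : ℕ, y * x * x ^ i = x ^ i * (y * x) + (i : ℕ) • x ^ i := by
    intro i
    cases i with
    | zero => simp
    | succ i =>
      rw [mul_assoc, ← pow_succ', pow_succ, ← mul_assoc, wy_pow h, add_mul, ← nsmul_eq_mul,
        smul_mul_assoc, ← pow_succ, mul_assoc]
  have h2 : ∀ j : ℕ, y ^ j * (y * x) = y * x * y ^ j + (j : ℕ) • y ^ j := by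
    intro j
    cases j with
    | zero => simp
    | succ j =>
      rw [← mul_assoc, ← pow_succ, pow_succ', mul_assoc, wy_pow' h, mul_add, ← mul_assoc,
        ← nsmul_eq_mul, mul_smul_comm, ← pow_succ']
  rw [wyAd_apply, ← mul_assoc, h1, mul_assoc (x^i), h2, sub_smul, Nat.cast_smul_eq_nsmul,
    Nat.cast_smul_eq_nsmul, mul_add, add_mul, smul_mul_assoc, mul_smul_comm]
  noncomm_ring

lemma wy_part1 {x y : A} (h : y * x = x * y + 1) (a : A)
    (hc : y * x * a = a * (y * x)) (ha : a ∈ Algebra.adjoin K {x, y}) :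
    a ∈ Algebra.adjoin K {y * x} := by
  obtain ⟨n, hn⟩ := wy_span h a ha
  have key : a ∈ Subalgebra.toSubmodule (Algebra.adjoin K {y * x}) ⊔
      ⨆ k : K, ⨆ (_ : k ≠ 0), Module.End.eigenspace (wyAd K (y * x)) k := by
    refine (Submodule.span_le.2 ?_) hn
    rintro _ ⟨i, j, -, -, rfl⟩
    by_cases hij : i = j
    · subst hij
      exact Submodule.mem_sup_left (wy_b_mem h i)
    · refine Submodule.mem_sup_right ?_
      refine Submodule.mem_iSup_of_mem ((i : K) - j) (Submodule.mem_iSup_of_mem ?_ ?_)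
      · rw [sub_ne_zero]; exact_mod_cast hij
      · rw [Module.End.mem_eigenspace_iff]; exact wy_weight h i j
  obtain ⟨b, hb, c, hc', rfl⟩ := Submodule.mem_sup.1 key
  have hb' : y * x * b = b * (y * x) := by
    have := Algebra.adjoin_le_centralizer_centralizer K {y * x} hb
    rw [Subalgebra.mem_centralizer_iff] at this
    exact this _ (by intro t ht; rw [Set.mem_singleton_iff.1 ht])
  have hc0 : c ∈ Module.End.eigenspace (wyAd K (y * x)) 0 := by
    rw [Module.End.mem_eigenspace_iff, wyAd_apply, zero_smul, sub_eq_zero]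
    rw [mul_add, add_mul, hb'] at hc
    exact add_left_cancel hc
  have := (Module.End.eigenspaces_iSupIndep (wyAd K (y * x))) 0
  have := Submodule.disjoint_def.1 this c hc0 hc'
  subst this
  simpa using hb

variable (K) in
def wyDelta (x y : A) : A →ₗ[K] A := wyAd K x ∘ₗ wyAd K y

lemma wy_delta_b {x y : A} (h : y * x = x * y + 1) (n : ℕ) :
    wyDelta K x y (x ^ (n+1) * y ^ (n+1)) = -((n+1 : K)^2) • (x ^ n * y ^ n) := by
  have e1 : y * (x ^ (n+1) * y ^ (n+1)) - (x ^ (n+1) * y ^ (n+1)) * y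
      = (n+1 : ℕ) • (x ^ n * y ^ (n+1)) := by
    rw [← mul_assoc, wy_pow h, add_mul, mul_assoc _ y, mul_assoc _ _ y, ← pow_succ, ← pow_succ',
      ← nsmul_eq_mul, smul_mul_assoc, add_sub_cancel_left]
  have e2 : x * (x ^ n * y ^ (n+1)) - (x ^ n * y ^ (n+1)) * x = -((n+1 : ℕ) • (x ^ n * y ^ n)) := by
    rw [mul_assoc _ _ x, wy_pow' h, mul_add, ← mul_assoc x, ← pow_succ', ← mul_assoc _ x,
      ← pow_succ, ← nsmul_eq_mul, mul_smul_comm]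
    abel
  rw [wyDelta, LinearMap.comp_apply, wyAd_apply y, e1, map_nsmul, wyAd_apply, e2,
    ← Nat.cast_smul_eq_nsmul K, ← Nat.cast_smul_eq_nsmul K, smul_neg, smul_smul, neg_smul]
  push_cast
  rw [sq]

lemma wy_nilp {x y : A} (h : y * x = x * y + 1) (a : A)
    (ha : a ∈ Algebra.adjoin K {y * x}) : ∃ n, 1 ≤ n ∧ (wyDelta K x y ^ n) a = 0 := by
  have up : ∀ (m n : ℕ) (a : A), m ≤ n → (wyDelta K x y ^ m) a = 0 →
      (wyDelta K x y ^ n) a = 0 := by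
    intro m n a hmn h0
    obtain ⟨k, rfl⟩ := Nat.exists_eq_add_of_le hmn
    rw [add_comm, pow_add, Module.End.mul_apply, h0, map_zero]
  have ha' := wy_adjoin_span h a ha
  clear ha
  induction ha' using Submodule.span_induction with
  | mem a ha =>
    obtain ⟨n, rfl⟩ := ha
    refine ⟨n+1, by omega, ?_⟩
    simp only
    induction n with
    | zero => simp [wyDelta, wyAd_apply]
    | succ n ih => rw [pow_succ, Module.End.mul_apply, wy_delta_b h, map_smul, ih, smul_zero]
  | zero => exact ⟨1, le_rfl, map_zero _⟩
  | add a b ha hb iha ihb =>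
    obtain ⟨m, hm, h1⟩ := iha
    obtain ⟨n, hn, h2⟩ := ihb
    exact ⟨max m n, by omega, by
      rw [map_add, up m _ a (le_max_left _ _) h1, up n _ b (le_max_right _ _) h2, add_zero]⟩
  | smul k a ha iha =>
    obtain ⟨m, hm, h1⟩ := iha
    exact ⟨m, hm, by rw [map_smul, h1, smul_zero]⟩

lemma wy_surj {x y : A} (h : y * x = x * y + 1) (a : A)
    (ha : a ∈ Algebra.adjoin K {y * x}) :
    ∃ b ∈ Algebra.adjoin K {y * x}, wyDelta K x y b = a := by
  have : Submodule.span K (Set.range fun n : ℕ => x ^ n * y ^ n) ≤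
      (Subalgebra.toSubmodule (Algebra.adjoin K {y * x})).map (wyDelta K x y) := by
    refine Submodule.span_le.2 ?_
    rintro _ ⟨n, rfl⟩
    refine ⟨(-((n+1 : K)^2))⁻¹ • (x ^ (n+1) * y ^ (n+1)),
      Subalgebra.smul_mem _ (wy_b_mem h _) _, ?_⟩
    rw [map_smul, wy_delta_b h, smul_smul, inv_mul_cancel₀, one_smul]
    have : (n : K) + 1 ≠ 0 := by exact_mod_cast Nat.succ_ne_zero n
    simpa using this
  obtain ⟨b, hb, e⟩ := this (wy_adjoin_span h a ha)
  exact ⟨b, hb, e⟩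

lemma wy_ker [IsDomain A] {x y : A} (h : y * x = x * y + 1)
    (H2 : ∀ z : A, y * z = z * y → x * z = z * x → ∃ k, z = algebraMap K A k)
    (H3 : ∀ (c : A) (k : K), c * x = algebraMap K A k → k = 0)
    (a : A) (hc : y * x * a = a * (y * x)) (hd : wyDelta K x y a = 0) :
    ∃ k, a = algebraMap K A k := by
  have hx : x ≠ 0 := by rintro rfl; simp at h
  have hy : y ≠ 0 := by rintro rfl; simp at h
  rw [wyDelta, LinearMap.comp_apply, wyAd_apply, wyAd_apply] at hd
  obtain ⟨c, hcd⟩ : ∃ c, c = y * a - a * y := ⟨_, rfl⟩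
  rw [← hcd] at hd
  have hxc : x * c = c * x := sub_eq_zero.1 hd
  have e0 : y * x * c - c * (y * x) = - c := by
    have hxy : x * y = y * x - 1 := by rw [h]; abel
    have t1 : y * x * y = y * (y * x) - y := by rw [mul_assoc, hxy]; noncomm_ring
    have t2 : y * x * c = y * (y * x * a) - y * a - (y * x * a) * y := by
      rw [hcd, mul_sub, ← mul_assoc _ y a, t1]; noncomm_ring
    have t3 : c * (y * x) = y * (a * (y * x)) - a * (y * (y * x)) := by
      rw [hcd]; noncomm_ring
    have t4 : a * (y * x) * y = a * (y * (y * x)) - a * y := by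
      rw [mul_assoc, t1, mul_sub]
    rw [t2, t3, hc, t4, hcd]; noncomm_ring
  have e1 : y * (c * x) = c * x * y := by
    have : y * (c * x) - c * (y * x) = - c := by rw [← e0, ← hxc, mul_assoc]
    have t : c * (y * x) = c * x * y + c := by rw [h]; noncomm_ring
    rw [t] at this
    calc y * (c * x) = (y * (c * x) - (c * x * y + c)) + (c * x * y + c) := by abel
      _ = _ := by rw [this]; abel
  obtain ⟨k, hk⟩ := H2 (c * x) e1 (by rw [← mul_assoc, hxc])
  have := H3 c k hk
  rw [this, map_zero] at hk
  have hc0 : c = 0 := (mul_eq_zero.1 hk).resolve_right hx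
  have hya : y * a = a * y := by rw [hc0] at hcd; exact (sub_eq_zero.1 hcd.symm)
  refine H2 a hya ?_
  apply mul_left_cancel₀ hy
  rw [← mul_assoc, hc, ← mul_assoc, ← mul_assoc, hya]

lemma wy_delta_comm {x y : A} (h : y * x = x * y + 1)
    (a : A) (hc : y * x * a = a * (y * x)) :
    y * x * wyDelta K x y a = wyDelta K x y a * (y * x) := by
  have e1 : y * x * x = x * (y * x) + x := by rw [h, add_mul, one_mul, mul_assoc, h]
  have e2 : y * x * y = y * (y * x) - y := by
    rw [mul_assoc, show x * y = y * x - 1 by rw [h]; abel]; noncomm_ring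
  generalize y * x = H at *
  have e1' : ∀ t, H * (x * t) = x * (H * t) + x * t := by
    intro t
    rw [← mul_assoc, e1]; noncomm_ring
  have e2' : ∀ t, H * (y * t) = y * (H * t) - y * t := by
    intro t
    rw [← mul_assoc, e2]; noncomm_ring
  have hc' : ∀ t, H * (a * t) = a * (H * t) := by
    intro t
    rw [← mul_assoc, hc, mul_assoc]
  simp only [wyDelta, LinearMap.comp_apply, wyAd_apply, mul_sub, sub_mul, mul_assoc, e1', e2', hc',
    hc, e1, e2, mul_add]
  abel

lemma wy_part2 [IsDomain A] {x y : A} (h : y * x = x * y + 1)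
    (H2 : ∀ z : A, y * z = z * y → x * z = z * x → ∃ k, z = algebraMap K A k)
    (H3 : ∀ (c : A) (k : K), c * x = algebraMap K A k → k = 0)
    (n : ℕ) : ∀ (a : A), y * x * a = a * (y * x) → (wyDelta K x y ^ n) a = 0 →
    a ∈ Algebra.adjoin K {y * x} := by
  induction n with
  | zero => intro a _ h0; rw [pow_zero, Module.End.one_apply] at h0; rw [h0]; exact zero_mem _
  | succ n ih =>
    intro a hc h0
    rw [pow_succ, Module.End.mul_apply] at h0
    obtain ⟨b, hb, e⟩ := wy_surj h _ (ih _ (wy_delta_comm h a hc) h0)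
    have hb' : y * x * b = b * (y * x) := by
      have := Algebra.adjoin_le_centralizer_centralizer K {y * x} hb
      rw [Subalgebra.mem_centralizer_iff] at this
      exact this _ (by intro t ht; rw [Set.mem_singleton_iff.1 ht])
    obtain ⟨k, hk⟩ := wy_ker h H2 H3 (a - b) (by rw [mul_sub, sub_mul, hc, hb'])
      (by rw [map_sub, e, sub_self])
    rw [sub_eq_iff_eq_add] at hk
    rw [hk]
    exact add_mem (Subalgebra.algebraMap_mem _ _) hb

end gen

lemma wy_indep (K : Type*) {A : Type*} [Field K] [CharZero K] [Ring A] [Algebra K A]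
    {u v : A} (h : v * u = u * v + 1) (n : ℕ) :
    ∀ c : ℕ → A, (∀ i, v * c i = c i * v) → ∑ i ∈ Finset.range n, c i * u ^ i = 0 →
    ∀ i < n, c i = 0 := by
  induction n with
  | zero => intro c _ _ i hi; omega
  | succ n ih =>
    intro c hc h0
    have key : ∑ i ∈ Finset.range n, ((i+1 : ℕ) • c (i+1)) * u ^ i = 0 := by
      have e : v * (∑ i ∈ Finset.range (n+1), c i * u ^ i) -
          (∑ i ∈ Finset.range (n+1), c i * u ^ i) * v = 0 := by rw [h0]; simp
      rw [Finset.mul_sum, Finset.sum_mul, ← Finset.sum_sub_distrib,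
        Finset.sum_range_succ'] at e
      simp only [pow_zero, mul_one, hc 0, sub_self, add_zero] at e
      rw [← e]
      refine Finset.sum_congr rfl fun i _ => ?_
      rw [← mul_assoc, hc, mul_assoc, wy_pow h, mul_add, ← mul_assoc, ← mul_assoc,
        add_sub_cancel_left, nsmul_eq_mul, (Nat.cast_commute (i+1) (c (i+1))).eq, mul_assoc]
    have h1 := ih (fun i => (i+1 : ℕ) • c (i+1)) (by
      intro i; simp only [mul_smul_comm, smul_mul_assoc, hc]) key
    have h2 : ∀ i < n, c (i+1) = 0 := by
      intro i hi
      have := h1 i hi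
      simp only [← Nat.cast_smul_eq_nsmul K] at this
      rcases smul_eq_zero.1 this with h | h
      · exact absurd h (by exact_mod_cast Nat.succ_ne_zero i)
      · exact h
    intro i hi
    cases i with
    | succ i => exact h2 i (by omega)
    | zero =>
      rw [Finset.sum_range_succ', Finset.sum_eq_zero] at h0
      · simpa using h0
      · intro i hi; rw [h2 i (Finset.mem_range.1 hi), zero_mul]

lemma wy_indep' (K : Type*) {A : Type*} [Field K] [CharZero K] [Ring A] [Algebra K A]
    {x y : A} (h : y * x = x * y + 1) (n : ℕ)
    (c : ℕ → A) (hc : ∀ i, x * c i = c i * x) (h0 : ∑ i ∈ Finset.range n, c i * y ^ i = 0) :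
    ∀ i < n, c i = 0 :=
  wy_indep K (u := y) (v := -x) (by rw [neg_mul, mul_neg, h]; abel) n c
    (by intro i; rw [neg_mul, mul_neg, hc]) h0

section model
open Polynomial
variable (K : Type*) [Field K] [CharZero K]

noncomputable def wX : WeylAlgebra K := RingQuot.mkAlgHom K (weylRel K) (FreeAlgebra.ι K 0)
noncomputable def wY : WeylAlgebra K := RingQuot.mkAlgHom K (weylRel K) (FreeAlgebra.ι K 1)

lemma wYX : wY K * wX K = wX K * wY K + 1 := by
  have := RingQuot.mkAlgHom_rel K (s := weylRel K) ⟨rfl, rfl⟩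
  simpa [wX, wY] using this

lemma w_top : Algebra.adjoin K {wX K, wY K} = ⊤ := by
  have h1 : Algebra.adjoin K (Set.range (FreeAlgebra.ι K (X := Fin 2))) = ⊤ :=
    FreeAlgebra.adjoin_range_ι K _
  have h2 := congrArg (Subalgebra.map (RingQuot.mkAlgHom K (weylRel K))) h1
  rw [AlgHom.map_adjoin, Algebra.map_top,
    (AlgHom.range_eq_top _).2 (RingQuot.mkAlgHom_surjective K _)] at h2
  rw [← h2]
  congr 1
  ext a
  simp only [Set.mem_insert_iff, Set.mem_singleton_iff, Set.mem_image, Set.mem_range, wX, wY]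
  constructor
  · rintro (rfl | rfl)
    · exact ⟨_, ⟨0, rfl⟩, rfl⟩
    · exact ⟨_, ⟨1, rfl⟩, rfl⟩
  · rintro ⟨_, ⟨i, rfl⟩, rfl⟩
    fin_cases i
    · exact Or.inl rfl
    · exact Or.inr rfl

lemma wD_aux (F : K[X][X]) (i : ℕ) :
    (∑ k ∈ Finset.range (F.natDegree + 1), monomial k (derivative (F.coeff k))).coeff i
      = derivative (F.coeff i) := by
  rw [finsetSum_coeff]
  simp only [coeff_monomial, Finset.sum_ite_eq', Finset.mem_range]
  split_ifs with h
  · rfl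
  · rw [coeff_eq_zero_of_natDegree_lt (by omega), map_zero]

/-- coefficientwise derivative -/
noncomputable def wD : K[X][X] →ₗ[K] K[X][X] where
  toFun F := ∑ k ∈ Finset.range (F.natDegree + 1), monomial k (derivative (F.coeff k))
  map_add' F G := by
    ext1 i; rw [coeff_add, wD_aux, wD_aux, wD_aux, coeff_add, map_add]
  map_smul' c F := by
    ext1 i; rw [RingHom.id_apply, coeff_smul, wD_aux, wD_aux, coeff_smul, derivative_smul]

lemma wD_coeff (F : K[X][X]) (i : ℕ) : (wD K F).coeff i = derivative (F.coeff i) :=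
  wD_aux K F i

noncomputable def wT : K[X][X] →ₗ[K] K[X][X] :=
  wD K + LinearMap.mulLeft K (X : K[X][X])

noncomputable def wRho : WeylAlgebra K →ₐ[K] Module.End K K[X][X] :=
  RingQuot.liftAlgHom K ⟨FreeAlgebra.lift K ![LinearMap.mulLeft K (C X : K[X][X]), wT K], by
    rintro _ _ ⟨rfl, rfl⟩
    ext1 G
    simp only [map_mul, map_add, map_one, FreeAlgebra.lift_ι_apply, wT]
    have : wD K (C X * G) = G + C X * wD K G := by
      ext1 i
      rw [wD_coeff, coeff_C_mul, coeff_add, coeff_C_mul, wD_coeff, derivative_mul]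
      simp
    simp [this]
    ring⟩

lemma wRho_X (G : K[X][X]) : wRho K (wX K) G = C X * G := by
  simp [wRho, wX]

lemma wRho_Y : wRho K (wY K) = wT K := by
  simp [wRho, wY]

lemma wRho_aeval (p : K[X]) (G : K[X][X]) : wRho K (aeval (wX K) p) G = C p * G := by
  induction p using Polynomial.induction_on' with
  | add p q hp hq => simp [hp, hq, add_mul]
  | monomial n a =>
    rw [aeval_monomial, ← Algebra.smul_def, map_smul, map_pow, LinearMap.smul_apply]
    have : ∀ n : ℕ, ((wRho K (wX K)) ^ n) G = C (X ^ n) * G := by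
      intro n
      induction n with
      | zero => simp
      | succ n ih => rw [pow_succ', Module.End.mul_apply, ih, wRho_X]; simp [pow_succ']; ring
    rw [this, ← C_mul_X_pow_eq_monomial, C_mul, mul_assoc]
    ext1 i
    rw [coeff_smul, coeff_C_mul (a := C a), Polynomial.smul_eq_C_mul]

noncomputable def wPsi (F : K[X][X]) : WeylAlgebra K :=
  F.eval₂ ((aeval (wX K) : K[X] →ₐ[K] WeylAlgebra K) : K[X] →+* WeylAlgebra K) (wY K)

lemma wT_coeff (G : K[X][X]) (m : ℕ) (hG : G.natDegree ≤ m) (j : ℕ) :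
    ((wT K ^ j) G).natDegree ≤ m + j ∧ ((wT K ^ j) G).coeff (m + j) = G.coeff m := by
  induction j with
  | zero => simpa using hG
  | succ j ih =>
    rw [pow_succ', Module.End.mul_apply]
    generalize (wT K ^ j) G = H at ih
    have e : ∀ k, (wT K H).coeff (k+1) = derivative (H.coeff (k+1)) + H.coeff k := by
      intro k
      simp [wT, wD_coeff]
    have z : ∀ k, m + j < k → H.coeff k = 0 := fun k hk =>
      coeff_eq_zero_of_natDegree_lt (by omega)
    constructor
    · rw [natDegree_le_iff_coeff_eq_zero]
      intro N hN
      obtain ⟨k, rfl⟩ : ∃ k, N = k+1 := ⟨N-1, by omega⟩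
      rw [e, z _ (by omega), z _ (by omega)]; simp
    · rw [← add_assoc, e, z _ (by omega), ih.2]; simp

lemma wRho_psi (F G : K[X][X]) :
    wRho K (wPsi K F) G = F.sum fun j p => C p * (wT K ^ j) G := by
  rw [wPsi, eval₂_eq_sum, Polynomial.sum, Polynomial.sum, map_sum, LinearMap.sum_apply]
  refine Finset.sum_congr rfl fun j _ => ?_
  rw [map_mul, Module.End.mul_apply, map_pow, wRho_Y]
  exact wRho_aeval K _ _

lemma wRho_one (F : K[X][X]) : wRho K (wPsi K F) 1 = F := by
  have : ∀ j : ℕ, (wT K ^ j) 1 = X ^ j := by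
    intro j
    induction j with
    | zero => simp
    | succ j ih =>
      rw [pow_succ', Module.End.mul_apply, ih, pow_succ']
      have : wD K (X ^ j) = 0 := by
        ext1 i; rw [wD_coeff, coeff_X_pow]; split_ifs <;> simp
      simp [wT, this]
  rw [wRho_psi]
  simp only [this]
  exact F.sum_C_mul_X_pow_eq

lemma wPsi_inj : Function.Injective (wPsi K) := fun F G h => by
  rw [← wRho_one K F, ← wRho_one K G, h]

lemma wPsi_add (F G : K[X][X]) : wPsi K (F + G) = wPsi K F + wPsi K G := by
  simp [wPsi, eval₂_add]

lemma wPsi_C (q : K[X]) : wPsi K (C q) = aeval (wX K) q := by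
  simp [wPsi]

lemma wPsi_surj (a : WeylAlgebra K) : ∃ F, a = wPsi K F := by
  obtain ⟨n, hn⟩ := wy_span (wYX K) a (by rw [w_top]; trivial)
  induction hn using Submodule.span_induction with
  | mem a ha =>
    obtain ⟨i, j, -, -, rfl⟩ := ha
    refine ⟨C (X ^ i) * X ^ j, ?_⟩
    rw [C_mul_X_pow_eq_monomial, wPsi, eval₂_monomial]
    simp
  | zero => exact ⟨0, by simp [wPsi]⟩
  | add a b _ _ ha hb =>
    obtain ⟨F, rfl⟩ := ha
    obtain ⟨G, rfl⟩ := hb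
    exact ⟨F + G, (wPsi_add K F G).symm⟩
  | smul k a _ ha =>
    obtain ⟨F, rfl⟩ := ha
    refine ⟨C (C k) * F, ?_⟩
    rename_i hF
    clear hF
    induction F using Polynomial.induction_on' with
    | add p q hp hq =>
      rw [mul_add, wPsi_add, wPsi_add, smul_add, hp, hq]
    | monomial n a =>
      rw [C_mul_monomial, wPsi, wPsi, eval₂_monomial, eval₂_monomial]
      simp [Algebra.smul_def, mul_assoc]

/-- the symbol -/
noncomputable def wPhi (a : WeylAlgebra K) : K[X][X] := wRho K a 1

lemma wPsi_phi (a : WeylAlgebra K) : wPsi K (wPhi K a) = a := by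
  obtain ⟨F, rfl⟩ := wPsi_surj K a
  rw [wPhi, wRho_one]

lemma wPhi_psi (F : K[X][X]) : wPhi K (wPsi K F) = F := wRho_one K F

lemma wPhi_mul (a b : WeylAlgebra K) (n m : ℕ) (ha : (wPhi K a).natDegree ≤ n)
    (hb : (wPhi K b).natDegree ≤ m) : (wPhi K (a * b)).natDegree ≤ n + m ∧
    (wPhi K (a * b)).coeff (n + m) = (wPhi K a).coeff n * (wPhi K b).coeff m := by
  have e : wPhi K (a * b) = (wPhi K a).sum fun j p => C p * (wT K ^ j) (wPhi K b) := by
    rw [← wRho_psi, wPsi_phi, wPhi, map_mul, Module.End.mul_apply]; rfl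
  generalize wPhi K b = G at *
  generalize wPhi K a = F at *
  rw [e, Polynomial.sum_over_range' _ (by simp) (n+1) (by omega)]
  have z : ∀ j k, m + j < k → ((wT K ^ j) G).coeff k = 0 := fun j k hk =>
    coeff_eq_zero_of_natDegree_lt (by have := (wT_coeff K G m hb j).1; omega)
  constructor
  · rw [natDegree_le_iff_coeff_eq_zero]
    intro N hN
    rw [finsetSum_coeff]
    refine Finset.sum_eq_zero fun j hj => ?_
    rw [Finset.mem_range] at hj
    rw [coeff_C_mul, z j N (by omega), mul_zero]
  · rw [finsetSum_coeff, Finset.sum_range_succ, Finset.sum_eq_zero, zero_add, coeff_C_mul,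
      add_comm n m, (wT_coeff K G m hb n).2]
    intro j hj
    rw [Finset.mem_range] at hj
    rw [coeff_C_mul, z j _ (by omega), mul_zero]

lemma wPhi_ne {a : WeylAlgebra K} (h : a ≠ 0) : wPhi K a ≠ 0 := by
  intro h0
  apply h
  rw [← wPsi_phi K a, h0]; simp [wPsi]

instance wDomain : IsDomain (WeylAlgebra K) := by
  have : Nontrivial (WeylAlgebra K) := ⟨0, 1, fun h => by
    have := congrArg (wPhi K) h
    simp [wPhi] at this⟩
  have : NoZeroDivisors (WeylAlgebra K) := ⟨fun {a b} hab => by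
    by_contra! hne
    have := (wPhi_mul K a b _ _ le_rfl le_rfl).2
    rw [hab] at this
    have h2 : (wPhi K a).leadingCoeff * (wPhi K b).leadingCoeff = 0 := by
      rw [leadingCoeff, leadingCoeff, ← this]; simp [wPhi]
    rcases mul_eq_zero.1 h2 with h | h
    · exact wPhi_ne K hne.1 (leadingCoeff_eq_zero.1 h)
    · exact wPhi_ne K hne.2 (leadingCoeff_eq_zero.1 h)⟩
  exact NoZeroDivisors.to_isDomain _

lemma wPhi_algebraMap (k : K) : wPhi K (algebraMap K _ k) = C (C k) := by
  have : algebraMap K (WeylAlgebra K) k = wPsi K (C (C k)) := by simp [wPsi_C]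
  rw [this, wPhi_psi]

lemma w_H3 {x y : WeylAlgebra K} (h : y * x = x * y + 1) (c : WeylAlgebra K) (k : K)
    (hc : c * x = algebraMap K _ k) : k = 0 := by
  by_contra hk
  have hk' : algebraMap K (WeylAlgebra K) k ≠ 0 := by simpa using hk
  have hx : x ≠ 0 := by rintro rfl; simp at h
  have hc0 : c ≠ 0 := by rintro rfl; rw [zero_mul] at hc; exact hk' hc.symm
  have e := wPhi_mul K c x _ _ le_rfl le_rfl
  rw [hc, wPhi_algebraMap] at e
  have hne : (wPhi K c).leadingCoeff * (wPhi K x).leadingCoeff ≠ 0 :=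
    mul_ne_zero (by simpa using wPhi_ne K hc0) (by simpa using wPhi_ne K hx)
  have hd : (wPhi K c).natDegree + (wPhi K x).natDegree = 0 := by
    by_contra hd
    rw [coeff_C, if_neg hd] at e
    exact hne e.2.symm
  have e2 := e.2
  have hx0 : (wPhi K x).natDegree = 0 := by omega
  have hc1 : (wPhi K c).natDegree = 0 := by omega
  rw [hx0, hc1] at e2
  have hu : IsUnit ((wPhi K x).coeff 0) := by
    refine isUnit_of_dvd_unit (Dvd.intro_left _ e2.symm) ?_
    simpa using hk
  obtain ⟨r, hr, hr'⟩ := Polynomial.isUnit_iff.1 hu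
  have : x = algebraMap K _ r := by
    rw [← wPsi_phi K x, eq_C_of_natDegree_eq_zero hx0, ← hr', wPsi_C]; simp
  rw [this, ← Algebra.commutes] at h
  simp at h

lemma wPhi_pow (z : WeylAlgebra K) (k : ℕ) :
    (wPhi K (z ^ k)).natDegree ≤ k * (wPhi K z).natDegree ∧
    (wPhi K (z ^ k)).coeff (k * (wPhi K z).natDegree) = (wPhi K z).leadingCoeff ^ k := by
  induction k with
  | zero => simp [wPhi]
  | succ k ih =>
    have := wPhi_mul K (z ^ k) z _ _ ih.1 le_rfl
    rw [pow_succ, add_mul, one_mul, pow_succ, ← ih.2]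
    exact this

lemma w_transc (z : WeylAlgebra K) (p : K[X]) (hp : p ≠ 0) (h : aeval z p = 0) :
    ∃ k, z = algebraMap K _ k := by
  by_cases hn : (wPhi K z).natDegree = 0
  · obtain ⟨q, hq⟩ : ∃ q, z = aeval (wX K) q :=
      ⟨_, by rw [← wPsi_C, ← eq_C_of_natDegree_eq_zero hn, wPsi_phi]⟩
    rw [hq, ← aeval_comp, ← wPsi_C] at h
    have h0 : (C (p.comp q) : K[X][X]) = 0 := wPsi_inj K (by rw [h]; simp [wPsi])
    rw [C_eq_zero, comp_eq_zero_iff] at h0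
    have := (h0.resolve_left hp).2
    rw [hq, this]
    exact ⟨q.coeff 0, by simp⟩
  · exfalso
    have hz : (wPhi K z).leadingCoeff ≠ 0 := by
      intro h0; rw [leadingCoeff_eq_zero.1 h0] at hn; simp at hn
    have h1 : (wPhi K (aeval z p)).coeff (p.natDegree * (wPhi K z).natDegree) = 0 := by
      rw [h]; simp [wPhi]
    have h2 : wPhi K (aeval z p) = ∑ i ∈ Finset.range (p.natDegree + 1),
        p.coeff i • wPhi K (z ^ i) := by
      rw [aeval_eq_sum_range]; simp [wPhi]
    rw [h2, finsetSum_coeff, Finset.sum_range_succ, Finset.sum_eq_zero, zero_add,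
      coeff_smul, (wPhi_pow K z _).2] at h1
    · rcases smul_eq_zero.1 h1 with h | h
      · exact hp (leadingCoeff_eq_zero.1 h)
      · exact hz (eq_zero_of_pow_eq_zero h)
    · intro i hi
      rw [Finset.mem_range] at hi
      rw [coeff_smul, coeff_eq_zero_of_natDegree_lt (p := wPhi K (z ^ i)), smul_zero]
      refine lt_of_le_of_lt (wPhi_pow K z i).1 ?_
      exact Nat.mul_lt_mul_of_pos_right hi (by omega)


lemma w_filt (a : WeylAlgebra K) :
    ∃ d : ℕ, a ∈ (Submodule.span K {1, wX K, wY K}) ^ d := by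
  obtain ⟨n, hn⟩ := wy_span (wYX K) a (by rw [w_top]; trivial)
  refine ⟨n + n, ?_⟩
  have h1 : (1 : Submodule K (WeylAlgebra K)) ≤ Submodule.span K {1, wX K, wY K} := by
    rw [Submodule.one_eq_span]; exact Submodule.span_mono (by simp)
  refine Submodule.span_le.2 ?_ hn
  rintro _ ⟨i, j, hi, hj, rfl⟩
  rw [pow_add]
  refine Submodule.mul_mem_mul ?_ ?_
  · exact pow_le_pow_right₀ h1 hi (Submodule.pow_mem_pow _ (Submodule.subset_span (by simp)) i)
  · exact pow_le_pow_right₀ h1 hj (Submodule.pow_mem_pow _ (Submodule.subset_span (by simp)) j)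

lemma w_filt_box (n : ℕ) : (Submodule.span K {1, wX K, wY K}) ^ n ≤
    Submodule.span K {a | ∃ i j, i ≤ n ∧ j ≤ n ∧ a = wX K ^ i * wY K ^ j} := by
  induction n with
  | zero =>
    rw [pow_zero, Submodule.one_eq_span]
    exact Submodule.span_mono (by rintro _ rfl; exact ⟨0, 0, by simp⟩)
  | succ n ih =>
    rw [pow_succ', Submodule.mul_le]
    intro u hu a ha
    have ha' := ih ha
    have := wy_box (wYX K) n a ha'
    induction hu using Submodule.span_induction with
    | mem u hu =>
      rcases hu with rfl | rfl | rfl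
      · rw [one_mul]
        refine Submodule.span_mono ?_ ha'
        rintro _ ⟨i, j, hi, hj, rfl⟩
        exact ⟨i, j, by omega, by omega, rfl⟩
      · exact this.1
      · exact this.2
    | zero => simp
    | add u v _ _ hu hv => rw [add_mul]; exact add_mem hu hv
    | smul k u _ hu => rw [smul_mul_assoc]; exact Submodule.smul_mem _ _ hu

lemma w_H2 {x y : WeylAlgebra K} (h : y * x = x * y + 1) (z : WeylAlgebra K)
    (hy : y * z = z * y) (hx : x * z = z * x) : ∃ k, z = algebraMap K _ k := by
  by_contra hz
  have htr : ∀ p : K[X], aeval z p = 0 → p = 0 := fun p hp => by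
    by_contra hp0
    exact hz (w_transc K z p hp0 hp)
  set U : Submodule K (WeylAlgebra K) := Submodule.span K {1, wX K, wY K} with hU
  have h1 : (1 : Submodule K (WeylAlgebra K)) ≤ U := by
    rw [Submodule.one_eq_span]; exact Submodule.span_mono (by simp)
  obtain ⟨dx, hdx⟩ := w_filt K x
  obtain ⟨dy, hdy⟩ := w_filt K y
  obtain ⟨dz, hdz⟩ := w_filt K z
  obtain ⟨d, hd1, hxd, hyd, hzd⟩ : ∃ d, 1 ≤ d ∧ x ∈ U ^ d ∧ y ∈ U ^ d ∧ z ∈ U ^ d :=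
    ⟨dx + dy + dz + 1, by omega, pow_le_pow_right₀ h1 (by omega) hdx,
      pow_le_pow_right₀ h1 (by omega) hdy, pow_le_pow_right₀ h1 (by omega) hdz⟩
  have hpow : ∀ (t : WeylAlgebra K) (N k : ℕ), t ∈ U ^ d → k ≤ N → t ^ k ∈ U ^ (d * N) := by
    intro t N k ht hk
    refine pow_le_pow_right₀ h1 (Nat.mul_le_mul_left d hk) ?_
    rw [pow_mul]
    exact Submodule.pow_mem_pow _ ht k
  let N := 9 * d ^ 2
  let M := d * N + d * N + d * N
  let v : Fin (N+1) × Fin (N+1) × Fin (N+1) → WeylAlgebra K :=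
    fun p => z ^ (p.2.2 : ℕ) * y ^ (p.2.1 : ℕ) * x ^ (p.1 : ℕ)
  classical
  let w : Finset (WeylAlgebra K) := (Finset.range (M+1) ×ˢ Finset.range (M+1)).image
    fun p => wX K ^ p.1 * wY K ^ p.2
  have hspan : Set.range v ≤ Submodule.span K (w : Set (WeylAlgebra K)) := by
    rintro _ ⟨p, rfl⟩
    have hm : v p ∈ U ^ M := by
      simp only [M, v]
      rw [pow_add, pow_add]
      exact Submodule.mul_mem_mul (Submodule.mul_mem_mul (hpow _ _ _ hzd (by omega))
        (hpow _ _ _ hyd (by omega))) (hpow _ _ _ hxd (by omega))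
    refine Submodule.span_mono ?_ (w_filt_box K M hm)
    rintro _ ⟨i, j, hi, hj, rfl⟩
    simp only [w, Finset.coe_image, Set.mem_image]
    exact ⟨(i, j), by simp; omega, rfl⟩
  have hli : LinearIndependent K v := by
    rw [Fintype.linearIndependent_iff]
    intro g hg
    let g' : ℕ → ℕ → ℕ → K := fun i j k =>
      if h : i < N+1 ∧ j < N+1 ∧ k < N+1 then g (⟨i, h.1⟩, ⟨j, h.2.1⟩, ⟨k, h.2.2⟩) else 0
    have hg' : ∀ i j k : Fin (N+1), g' i j k = g (i, j, k) := by
      intro i j k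
      simp only [g']
      rw [dif_pos ⟨i.2, j.2, k.2⟩]
    let P : ℕ → ℕ → K[X] := fun i j => ∑ k ∈ Finset.range (N+1), C (g' i j k) * X ^ k
    have hcomm : ∀ (t : WeylAlgebra K) (p : K[X]), t * z = z * t → t * aeval z p = aeval z p * t := by
      intro t p ht
      induction p using Polynomial.induction_on' with
      | add p q hp hq => rw [map_add, mul_add, add_mul, hp, hq]
      | monomial n a =>
        rw [aeval_monomial, ← mul_assoc, ← Algebra.commutes, mul_assoc, mul_assoc,
          ((show Commute t z from ht).pow_right n).eq]
    have hsum : ∑ i ∈ Finset.range (N+1), (∑ j ∈ Finset.range (N+1),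
        aeval z (P i j) * y ^ j) * x ^ i = 0 := by
      rw [← hg, Fintype.sum_prod_type, Finset.sum_range]
      refine Finset.sum_congr rfl fun i _ => ?_
      rw [Fintype.sum_prod_type, Finset.sum_range, Finset.sum_mul]
      refine Finset.sum_congr rfl fun j _ => ?_
      simp only [P]
      rw [map_sum, Finset.sum_range, Finset.sum_mul, Finset.sum_mul]
      refine Finset.sum_congr rfl fun k _ => ?_
      rw [hg']
      simp only [v, map_mul, aeval_C, map_pow, aeval_X, Algebra.smul_def, mul_assoc]
    have s1 := wy_indep K h (N+1) (fun i => ∑ j ∈ Finset.range (N+1), aeval z (P i j) * y ^ j)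
      (by
        intro i
        simp only [Finset.mul_sum, Finset.sum_mul]
        refine Finset.sum_congr rfl fun j _ => ?_
        rw [← mul_assoc, hcomm y _ hy, mul_assoc, mul_assoc, ← pow_succ, ← pow_succ']) hsum
    have s2 : ∀ i < N+1, ∀ j < N+1, aeval z (P i j) = 0 := by
      intro i hi
      refine wy_indep' K h (N+1)
        (fun j => aeval z (P i j)) ?_ (s1 i hi)
      intro j
      exact hcomm x _ hx
    rintro ⟨i, j, k⟩
    have := congrArg (fun p => coeff p (k : ℕ)) (htr _ (s2 i i.2 j j.2))
    simp only [P, finsetSum_coeff, coeff_C_mul, coeff_X_pow, coeff_zero, mul_ite, mul_one,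
      mul_zero, Finset.sum_ite_eq, Finset.mem_range, k.2, if_true] at this
    rw [← hg']; exact this
  have hle := linearIndependent_le_span_aux' v hli (w : Set (WeylAlgebra K)) hspan
  have hw : w.card ≤ (M+1) * (M+1) := by
    refine Finset.card_image_le.trans ?_
    simp
  simp only [Finset.coe_sort_coe, Fintype.card_coe, Fintype.card_prod, Fintype.card_fin] at hle
  have hfin : (N+1) * ((N+1) * (N+1)) ≤ (M+1)*(M+1) := hle.trans hw
  have hM : M + 1 ≤ 3 * d * (N+1) := by simp only [M]; nlinarith
  have : (M+1)*(M+1) ≤ N * ((N+1)*(N+1)) := by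
    calc (M+1)*(M+1) ≤ (3 * d * (N+1)) * (3 * d * (N+1)) := Nat.mul_le_mul hM hM
      _ = _ := by simp only [N]; ring
  have hpos : 0 < (N+1)*(N+1) := by positivity
  nlinarith

end model

/-- **Proposition 2.8.(4,5).** Suppose `[y,x] = 1` for elements `x, y` of the Weyl algebra
`A₁` over a field `K` of characteristic zero; let `A₁' = K⟨x,y⟩`, `h := yx` and
`δ := ad(x) ∘ ad(y)` (so `δ(a) = [x, [y, a]]`; it maps the centralizer `C(h)` into
itself). Then:
1. `C(h) ∩ A₁' = K[h]`;
2. `C(h) = K[h]` if and only if `δ` acts locally nilpotently on `C(h)`. -/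
theorem centralizer_h_inter_and_loc_nilp (K : Type*) [Field K] [CharZero K]
    (x y : WeylAlgebra K) (hxy : y * x - x * y = 1) :
    (Subalgebra.centralizer K ({y * x} : Set (WeylAlgebra K))
        ⊓ Algebra.adjoin K ({x, y} : Set (WeylAlgebra K))
      = Algebra.adjoin K ({y * x} : Set (WeylAlgebra K)))
    ∧ (Subalgebra.centralizer K ({y * x} : Set (WeylAlgebra K))
        = Algebra.adjoin K ({y * x} : Set (WeylAlgebra K))
      ↔ ∀ a ∈ Subalgebra.centralizer K ({y * x} : Set (WeylAlgebra K)),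
          ∃ n : ℕ, 1 ≤ n ∧
            (fun c => x * (y * c - c * y) - (y * c - c * y) * x)^[n] a = 0) := by
  have h : y * x = x * y + 1 := by rw [← hxy]; abel
  have hdel : ∀ n (a : WeylAlgebra K),
      (fun c => x * (y * c - c * y) - (y * c - c * y) * x)^[n] a = (wyDelta K x y ^ n) a := by
    intro n a
    rw [Module.End.pow_apply]
    refine congrArg (fun f => f^[n] a) ?_
    funext c
    rw [wyDelta, LinearMap.comp_apply, wyAd_apply, wyAd_apply]
  have hcent : ∀ a, a ∈ Subalgebra.centralizer K ({y * x} : Set (WeylAlgebra K)) ↔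
      y * x * a = a * (y * x) := by
    intro a
    rw [Subalgebra.mem_centralizer_iff]
    simp
  have hle : Algebra.adjoin K ({y * x} : Set (WeylAlgebra K)) ≤
      Subalgebra.centralizer K ({y * x} : Set (WeylAlgebra K)) := by
    refine Algebra.adjoin_le ?_
    rintro _ rfl
    exact (hcent _).2 rfl
  refine ⟨le_antisymm ?_ (le_inf hle ?_), ?_, ?_⟩
  · rintro a ⟨h1, h2⟩
    exact wy_part1 h a ((hcent a).1 h1) h2
  · refine Algebra.adjoin_le ?_
    rintro _ rfl
    exact mul_mem (Algebra.subset_adjoin (by simp)) (Algebra.subset_adjoin (by simp))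
  · intro he a ha
    rw [he] at ha
    obtain ⟨n, hn, h0⟩ := wy_nilp h a ha
    exact ⟨n, hn, by rw [hdel, h0]⟩
  · intro H
    refine le_antisymm ?_ hle
    intro a ha
    obtain ⟨n, -, h0⟩ := H a ha
    rw [hdel] at h0
    exact wy_part2 h (fun z h1 h2 => w_H2 K h z h1 h2) (fun c k hc => w_H3 K h c k hc) n a
      ((hcent a).1 ha) h0
end
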